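/- arXiv:1603.02820 — 2 statements merged into one kernel-verified Lean document; each statement's English description precedes it below -/
import Mathlib

section
/- Let (γ, T, W₁, N, W₂, η, k₁, k₂) be a Cartan framed null variation, let V(σ) = ∂γ/∂t(σ,0), and along t = 0 set (with ′ = ∂/∂σ evaluated at t = 0) φ_V = ε₁⟨V′, W₁⟩, ψ_V = ε₂⟨V′, W₂⟩, ρ_V = −ε₁⟨V″, W₁⟩, α_V = (1/a)(φ_V′ + ρ_V/2), β_V = (1/a)(α_V′ + k₁φ_V − k₂ψ_V), δ_V = (1/a)ψ_V″ + k₁ψ_V + ε₁ε₂k₂φ_V (k₁, k₂ evaluated at t = 0). Then for all σ ∈ I, at (σ,0): ∂T/∂t = −α_V T + φ_V W₁ + ψ_V W₂; ∂W₁/∂t = −β_V T + ε₁φ_V N + (1/a)ψ_V′ W₂; ∂N/∂t = −ε₁β_V W₁ + α_V N + (ε₁/a)δ_V W₂; ∂W₂/∂t = (ε₁ε₂/a)δ_V T − (ε₁ε₂/a)ψ_V′ W₁ + ε₂ψ_V N. -/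
noncomputable section

/-- Vectors of `ℝ⁴`. -/
abbrev V4 : Type := Fin 4 → ℝ

/-- A Cartan framed null variation in the flat pseudo-Euclidean `ℝ⁴` with symmetric
bilinear form `B`, constant `a` and signs `ε₁`, `ε₂`: smooth maps
`γ, T, W₁, N, W₂ : I × J → ℝ⁴`, a smooth positive function `η` with `η(·,0) = 1` and
`∂γ/∂σ = η T`, smooth curvatures `k₁, k₂`, such that the frame relations and the Cartan
equations hold at every point of `I × J`. -/
structure CartanVariation (B : V4 →ₗ[ℝ] V4 →ₗ[ℝ] ℝ) (a ε₁ ε₂ : ℝ) where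
  I : Set ℝ
  J : Set ℝ
  I_open : IsOpen I
  J_open : IsOpen J
  I_conn : I.OrdConnected
  J_conn : J.OrdConnected
  I_ne : I.Nonempty
  J_zero : (0 : ℝ) ∈ J
  γ : ℝ → ℝ → V4
  T : ℝ → ℝ → V4
  W₁ : ℝ → ℝ → V4
  N : ℝ → ℝ → V4
  W₂ : ℝ → ℝ → V4
  η : ℝ → ℝ → ℝ
  k₁ : ℝ → ℝ → ℝ
  k₂ : ℝ → ℝ → ℝ
  smooth_γ : ContDiffOn ℝ (⊤ : ℕ∞) (fun p : ℝ × ℝ => γ p.1 p.2) (I ×ˢ J)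
  smooth_T : ContDiffOn ℝ (⊤ : ℕ∞) (fun p : ℝ × ℝ => T p.1 p.2) (I ×ˢ J)
  smooth_W₁ : ContDiffOn ℝ (⊤ : ℕ∞) (fun p : ℝ × ℝ => W₁ p.1 p.2) (I ×ˢ J)
  smooth_N : ContDiffOn ℝ (⊤ : ℕ∞) (fun p : ℝ × ℝ => N p.1 p.2) (I ×ˢ J)
  smooth_W₂ : ContDiffOn ℝ (⊤ : ℕ∞) (fun p : ℝ × ℝ => W₂ p.1 p.2) (I ×ˢ J)
  smooth_η : ContDiffOn ℝ (⊤ : ℕ∞) (fun p : ℝ × ℝ => η p.1 p.2) (I ×ˢ J)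
  smooth_k₁ : ContDiffOn ℝ (⊤ : ℕ∞) (fun p : ℝ × ℝ => k₁ p.1 p.2) (I ×ˢ J)
  smooth_k₂ : ContDiffOn ℝ (⊤ : ℕ∞) (fun p : ℝ × ℝ => k₂ p.1 p.2) (I ×ˢ J)
  η_pos : ∀ σ ∈ I, ∀ t ∈ J, 0 < η σ t
  η_one : ∀ σ ∈ I, η σ 0 = 1
  γ_deriv : ∀ σ ∈ I, ∀ t ∈ J, deriv (fun s => γ s t) σ = η σ t • T σ t
  B_TT : ∀ σ ∈ I, ∀ t ∈ J, B (T σ t) (T σ t) = 0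
  B_NN : ∀ σ ∈ I, ∀ t ∈ J, B (N σ t) (N σ t) = 0
  B_TN : ∀ σ ∈ I, ∀ t ∈ J, B (T σ t) (N σ t) = -1
  B_W₁T : ∀ σ ∈ I, ∀ t ∈ J, B (W₁ σ t) (T σ t) = 0
  B_W₁N : ∀ σ ∈ I, ∀ t ∈ J, B (W₁ σ t) (N σ t) = 0
  B_W₂T : ∀ σ ∈ I, ∀ t ∈ J, B (W₂ σ t) (T σ t) = 0
  B_W₂N : ∀ σ ∈ I, ∀ t ∈ J, B (W₂ σ t) (N σ t) = 0
  B_W₁W₂ : ∀ σ ∈ I, ∀ t ∈ J, B (W₁ σ t) (W₂ σ t) = 0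
  B_W₁W₁ : ∀ σ ∈ I, ∀ t ∈ J, B (W₁ σ t) (W₁ σ t) = ε₁
  B_W₂W₂ : ∀ σ ∈ I, ∀ t ∈ J, B (W₂ σ t) (W₂ σ t) = ε₂
  cartan_T : ∀ σ ∈ I, ∀ t ∈ J,
    deriv (fun s => T s t) σ = η σ t • (a • W₁ σ t)
  cartan_W₁ : ∀ σ ∈ I, ∀ t ∈ J,
    deriv (fun s => W₁ s t) σ = η σ t • ((-(k₁ σ t)) • T σ t + (a * ε₁) • N σ t)
  cartan_N : ∀ σ ∈ I, ∀ t ∈ J,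
    deriv (fun s => N s t) σ =
      η σ t • ((-(ε₁ * k₁ σ t)) • W₁ σ t + (ε₂ * k₂ σ t) • W₂ σ t)
  cartan_W₂ : ∀ σ ∈ I, ∀ t ∈ J,
    deriv (fun s => W₂ s t) σ = η σ t • (k₂ σ t • T σ t)

namespace CartanVariation

variable {B : V4 →ₗ[ℝ] V4 →ₗ[ℝ] ℝ} {a ε₁ ε₂ : ℝ}

/-- The variation vector field `V(σ) = ∂γ/∂t (σ, 0)`. -/
def Vf (CV : CartanVariation B a ε₁ ε₂) : ℝ → V4 :=
  fun s => deriv (fun u => CV.γ s u) 0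

/-- `φ_V = ε₁⟨V′, W₁⟩` along `t = 0`. -/
def phiV (CV : CartanVariation B a ε₁ ε₂) : ℝ → ℝ :=
  fun s => ε₁ * B (deriv CV.Vf s) (CV.W₁ s 0)

/-- `ψ_V = ε₂⟨V′, W₂⟩` along `t = 0`. -/
def psiV (CV : CartanVariation B a ε₁ ε₂) : ℝ → ℝ :=
  fun s => ε₂ * B (deriv CV.Vf s) (CV.W₂ s 0)

/-- `ρ_V = −ε₁⟨V″, W₁⟩` along `t = 0`. -/
def rhoV (CV : CartanVariation B a ε₁ ε₂) : ℝ → ℝ :=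
  fun s => -ε₁ * B (deriv (deriv CV.Vf) s) (CV.W₁ s 0)

/-- `α_V = (1/a)(φ_V′ + ρ_V/2)`. -/
def alphaV (CV : CartanVariation B a ε₁ ε₂) : ℝ → ℝ :=
  fun s => (1 / a) * (deriv CV.phiV s + CV.rhoV s / 2)

/-- `β_V = (1/a)(α_V′ + k₁φ_V − k₂ψ_V)` (case `G = 0`). -/
def betaV (CV : CartanVariation B a ε₁ ε₂) : ℝ → ℝ :=
  fun s => (1 / a) * (deriv CV.alphaV s + CV.k₁ s 0 * CV.phiV s - CV.k₂ s 0 * CV.psiV s)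

/-- `δ_V = (1/a)ψ_V″ + k₁ψ_V + ε₁ε₂k₂φ_V`. -/
def deltaV (CV : CartanVariation B a ε₁ ε₂) : ℝ → ℝ :=
  fun s => (1 / a) * deriv (deriv CV.psiV) s + CV.k₁ s 0 * CV.psiV s
    + ε₁ * ε₂ * CV.k₂ s 0 * CV.phiV s

end CartanVariation

/-- A smooth function of two real variables has smooth partial derivatives. -/
theorem contDiffOn_deriv_snd {E : Type*} [NormedAddCommGroup E] [NormedSpace ℝ E]
    {F : ℝ → ℝ → E} {U : Set (ℝ × ℝ)} (hU : IsOpen U)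
    (hF : ContDiffOn ℝ (⊤ : ℕ∞) (fun p : ℝ × ℝ => F p.1 p.2) U) :
    ContDiffOn ℝ (⊤ : ℕ∞) (fun p : ℝ × ℝ => deriv (fun u => F p.1 u) p.2) U := by
  have h1 : ContDiffOn ℝ (⊤ : ℕ∞) (fderiv ℝ (fun p : ℝ × ℝ => F p.1 p.2)) U :=
    hF.fderiv_of_isOpen hU (by simp)
  refine (h1.clm_apply (contDiffOn_const (c := ((0 : ℝ), (1 : ℝ))))).congr fun p hp => ?_
  have hd : HasFDerivAt (fun p : ℝ × ℝ => F p.1 p.2) _ (p.1, p.2) :=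
    ((hF.contDiffAt (hU.mem_nhds hp)).differentiableAt (by simp)).hasFDerivAt
  exact (hd.comp_hasDerivAt p.2
    ((hasDerivAt_const p.2 p.1).prodMk (hasDerivAt_id p.2))).deriv

/-- The mixed partial derivatives of a smooth function of two real variables agree. -/
theorem hasDerivAt_deriv_snd {E : Type*} [NormedAddCommGroup E] [NormedSpace ℝ E]
    {F : ℝ → ℝ → E} {U : Set (ℝ × ℝ)} (hU : IsOpen U)
    (hF : ContDiffOn ℝ (⊤ : ℕ∞) (fun p : ℝ × ℝ => F p.1 p.2) U) {σ t : ℝ} (hp : (σ, t) ∈ U) :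
    HasDerivAt (fun s => deriv (fun u => F s u) t)
      (deriv (fun u => deriv (fun s => F s u) σ) t) σ := by
  set f : ℝ × ℝ → E := fun p => F p.1 p.2 with hf
  have hf' : ∀ p ∈ U, HasFDerivAt f (fderiv ℝ f p) p := fun p hp =>
    ((hF.contDiffAt (hU.mem_nhds hp)).differentiableAt (by simp)).hasFDerivAt
  have hsnd : ∀ p ∈ U, deriv (fun u => F p.1 u) p.2 = fderiv ℝ f p (0, 1) := fun p hp =>
    ((hf' p hp).comp_hasDerivAt (x := p.2) (f := fun u => (p.1, u))
      ((hasDerivAt_const p.2 p.1).prodMk (hasDerivAt_id p.2))).deriv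
  have hfst : ∀ p ∈ U, deriv (fun s => F s p.2) p.1 = fderiv ℝ f p (1, 0) := fun p hp =>
    ((hf' p hp).comp_hasDerivAt (x := p.1) (f := fun s => (s, p.2))
      ((hasDerivAt_id p.1).prodMk (hasDerivAt_const p.1 p.2))).deriv
  have hf'' : HasFDerivAt (fderiv ℝ f) (fderiv ℝ (fderiv ℝ f) (σ, t)) (σ, t) :=
    (((hF.fderiv_of_isOpen hU (m := (⊤ : ℕ∞)) (by simp)).contDiffAt
      (hU.mem_nhds hp)).differentiableAt (by simp)).hasFDerivAt
  have hsymm := second_derivative_symmetric_of_eventually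
    (Filter.eventually_of_mem (hU.mem_nhds hp) hf') hf'' (1, 0) (0, 1)
  have hσ : HasDerivAt (fun s : ℝ => (s, t)) (1, 0) σ :=
    (hasDerivAt_id σ).prodMk (hasDerivAt_const σ t)
  have ht : HasDerivAt (fun u : ℝ => (σ, u)) (0, 1) t :=
    (hasDerivAt_const t σ).prodMk (hasDerivAt_id t)
  have e1 : (fun s => deriv (fun u => F s u) t) =ᶠ[nhds σ]
      fun s => fderiv ℝ f (s, t) (0, 1) :=
    Filter.eventually_of_mem (hσ.continuousAt.preimage_mem_nhds (hU.mem_nhds hp))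
      fun s hs => hsnd (s, t) hs
  have e2 : (fun u => deriv (fun s => F s u) σ) =ᶠ[nhds t]
      fun u => fderiv ℝ f (σ, u) (1, 0) :=
    Filter.eventually_of_mem (ht.continuousAt.preimage_mem_nhds (hU.mem_nhds hp))
      fun u hu => hfst (σ, u) hu
  have d1 : HasDerivAt (fun s => fderiv ℝ f (s, t) (0, 1))
      (fderiv ℝ (fderiv ℝ f) (σ, t) (1, 0) (0, 1)) σ :=
    ((ContinuousLinearMap.apply ℝ E ((0 : ℝ), (1 : ℝ))).hasFDerivAt.comp (σ, t)
      hf'').comp_hasDerivAt (f := fun s : ℝ => (s, t)) σ hσ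
  have d2 : HasDerivAt (fun u => fderiv ℝ f (σ, u) (1, 0))
      (fderiv ℝ (fderiv ℝ f) (σ, t) (0, 1) (1, 0)) t :=
    ((ContinuousLinearMap.apply ℝ E ((1 : ℝ), (0 : ℝ))).hasFDerivAt.comp (σ, t)
      hf'').comp_hasDerivAt (f := fun u : ℝ => (σ, u)) t ht
  rw [e2.deriv_eq, d2.deriv, ← hsymm]
  exact d1.congr_of_eventuallyEq e1

/-- The product rule for a bilinear form on `ℝ⁴`. -/
theorem hasDerivAt_bilin (B : V4 →ₗ[ℝ] V4 →ₗ[ℝ] ℝ) {f g : ℝ → V4} {f' g' : V4} {x : ℝ}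
    (hf : HasDerivAt f f' x) (hg : HasDerivAt g g' x) :
    HasDerivAt (fun s => B (f s) (g s)) (B f' (g x) + B (f x) g') x := by
  have h := (LinearMap.toContinuousBilinearMap B).hasDerivAt_of_bilinear (fun _ => hf) (fun _ => hg)
  simpa [add_comm] using h

/-- The expansion of a vector of `ℝ⁴` in a Cartan frame. -/
theorem cartan_frame_expansion {B : V4 →ₗ[ℝ] V4 →ₗ[ℝ] ℝ} (hB : ∀ v w, B v w = B w v)
    {ε₁ ε₂ : ℝ} (h₁ : ε₁ * ε₁ = 1) (h₂ : ε₂ * ε₂ = 1) {T W₁ N W₂ : V4}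
    (hTT : B T T = 0) (hNN : B N N = 0) (hTN : B T N = -1) (hW₁T : B W₁ T = 0)
    (hW₁N : B W₁ N = 0) (hW₂T : B W₂ T = 0) (hW₂N : B W₂ N = 0) (hW₁W₂ : B W₁ W₂ = 0)
    (hW₁W₁ : B W₁ W₁ = ε₁) (hW₂W₂ : B W₂ W₂ = ε₂) (v : V4) :
    v = (-(B v N)) • T + (ε₁ * B v W₁) • W₁ + (-(B v T)) • N + (ε₂ * B v W₂) • W₂ := by
  have hNT : B N T = -1 := (hB N T).trans hTN
  have hTW₁ : B T W₁ = 0 := (hB T W₁).trans hW₁T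
  have hNW₁ : B N W₁ = 0 := (hB N W₁).trans hW₁N
  have hTW₂ : B T W₂ = 0 := (hB T W₂).trans hW₂T
  have hNW₂ : B N W₂ = 0 := (hB N W₂).trans hW₂N
  have hW₂W₁ : B W₂ W₁ = 0 := (hB W₂ W₁).trans hW₁W₂
  have coord : ∀ c : Fin 4 → ℝ, ∀ w, c 0 • T + c 1 • W₁ + c 2 • N + c 3 • W₂ = w →
      -(B w N) = c 0 ∧ ε₁ * B w W₁ = c 1 ∧ -(B w T) = c 2 ∧ ε₂ * B w W₂ = c 3 := by
    rintro c w rfl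
    simp only [map_add, map_smul, LinearMap.add_apply, LinearMap.smul_apply, smul_eq_mul,
      hTT, hNN, hTN, hW₁T, hW₁N, hW₂T, hW₂N, hW₁W₂, hW₁W₁, hW₂W₂, hNT, hTW₁, hNW₁, hTW₂, hNW₂,
      hW₂W₁]
    refine ⟨by ring, ?_, by ring, ?_⟩
    · linear_combination c 1 * h₁
    · linear_combination c 3 * h₂
  have hli : LinearIndependent ℝ ![T, W₁, N, W₂] := by
    rw [Fintype.linearIndependent_iff]
    intro c hc
    simp only [Fin.sum_univ_four, Matrix.cons_val] at hc
    obtain ⟨h0, h1, h2, h3⟩ := coord c 0 hc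
    simp only [map_zero, LinearMap.zero_apply, mul_zero, neg_zero] at h0 h1 h2 h3
    intro i
    fin_cases i
    exacts [h0.symm, h1.symm, h2.symm, h3.symm]
  let b := basisOfLinearIndependentOfCardEqFinrank hli (by simp)
  have hv : b.repr v 0 • T + b.repr v 1 • W₁ + b.repr v 2 • N + b.repr v 3 • W₂ = v := by
    simpa [b, Fin.sum_univ_four] using b.sum_repr v
  obtain ⟨h0, h1, h2, h3⟩ := coord (b.repr v) v hv
  rw [h0, h1, h2, h3, hv]

namespace CartanVariation

variable {B : V4 →ₗ[ℝ] V4 →ₗ[ℝ] ℝ} {a ε₁ ε₂ : ℝ}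

theorem domain_open (CV : CartanVariation B a ε₁ ε₂) : IsOpen (CV.I ×ˢ CV.J) :=
  CV.I_open.prod CV.J_open

theorem hasDerivAt_snd {E : Type*} [NormedAddCommGroup E] [NormedSpace ℝ E]
    (CV : CartanVariation B a ε₁ ε₂) {F : ℝ → ℝ → E}
    (hF : ContDiffOn ℝ (⊤ : ℕ∞) (fun p : ℝ × ℝ => F p.1 p.2) (CV.I ×ˢ CV.J))
    {σ : ℝ} (hσ : σ ∈ CV.I) :
    HasDerivAt (fun u => F σ u) (deriv (fun u => F σ u) 0) 0 := by
  have h := (hF.contDiffAt (x := (σ, 0)) (CV.domain_open.mem_nhds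
    ⟨hσ, CV.J_zero⟩)).differentiableAt (by simp)
  exact (h.comp (0 : ℝ) (f := fun u : ℝ => (σ, u)) (by fun_prop)).hasDerivAt

theorem hasDerivAt_fst {E : Type*} [NormedAddCommGroup E] [NormedSpace ℝ E]
    (CV : CartanVariation B a ε₁ ε₂) {F : ℝ → ℝ → E}
    (hF : ContDiffOn ℝ (⊤ : ℕ∞) (fun p : ℝ × ℝ => F p.1 p.2) (CV.I ×ˢ CV.J))
    {σ : ℝ} (hσ : σ ∈ CV.I) :
    HasDerivAt (fun s => F s 0) (deriv (fun s => F s 0) σ) σ := by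
  have h := (hF.contDiffAt (x := (σ, 0)) (CV.domain_open.mem_nhds
    ⟨hσ, CV.J_zero⟩)).differentiableAt (by simp)
  exact (h.comp σ (f := fun s : ℝ => (s, (0 : ℝ))) (by fun_prop)).hasDerivAt

/-- If `∂F/∂σ = G` on the domain, then `∂/∂σ (∂F/∂t) = ∂G/∂t` along `t = 0`. -/
theorem hasDerivAt_variation {E : Type*} [NormedAddCommGroup E] [NormedSpace ℝ E]
    (CV : CartanVariation B a ε₁ ε₂) {F : ℝ → ℝ → E} {G : ℝ → E} {G' : E}
    (hF : ContDiffOn ℝ (⊤ : ℕ∞) (fun p : ℝ × ℝ => F p.1 p.2) (CV.I ×ˢ CV.J))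
    {σ : ℝ} (hσ : σ ∈ CV.I) (hFG : ∀ t ∈ CV.J, deriv (fun s => F s t) σ = G t)
    (hG : HasDerivAt G G' 0) :
    HasDerivAt (fun s => deriv (fun u => F s u) 0) G' σ := by
  have h := hasDerivAt_deriv_snd CV.domain_open hF (σ := σ) (t := 0) ⟨hσ, CV.J_zero⟩
  have e : (fun u => deriv (fun s => F s u) σ) =ᶠ[nhds 0] G :=
    Filter.eventually_of_mem (CV.J_open.mem_nhds CV.J_zero) hFG
  rwa [e.deriv_eq, hG.deriv] at h

/-- If `⟨F, G⟩` is constant on the domain, its variation along `t = 0` vanishes. -/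
theorem bilin_variation (CV : CartanVariation B a ε₁ ε₂) {F G : ℝ → ℝ → V4} {c : ℝ}
    (hF : ContDiffOn ℝ (⊤ : ℕ∞) (fun p : ℝ × ℝ => F p.1 p.2) (CV.I ×ˢ CV.J))
    (hG : ContDiffOn ℝ (⊤ : ℕ∞) (fun p : ℝ × ℝ => G p.1 p.2) (CV.I ×ˢ CV.J))
    (h : ∀ σ ∈ CV.I, ∀ t ∈ CV.J, B (F σ t) (G σ t) = c) {σ : ℝ} (hσ : σ ∈ CV.I) :
    B (deriv (fun u => F σ u) 0) (G σ 0) + B (F σ 0) (deriv (fun u => G σ u) 0) = 0 := by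
  have e : (fun u => B (F σ u) (G σ u)) =ᶠ[nhds 0] fun _ => c :=
    Filter.eventually_of_mem (CV.J_open.mem_nhds CV.J_zero) (h σ hσ)
  rw [← (hasDerivAt_bilin B (CV.hasDerivAt_snd hF hσ) (CV.hasDerivAt_snd hG hσ)).deriv,
    e.deriv_eq, deriv_const]

section

variable (CV : CartanVariation B a ε₁ ε₂) {σ : ℝ}

theorem hasDerivAt_T (hσ : σ ∈ CV.I) :
    HasDerivAt (fun s => CV.T s 0) (a • CV.W₁ σ 0) σ := by
  have h := CV.hasDerivAt_fst CV.smooth_T hσ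
  rwa [CV.cartan_T σ hσ 0 CV.J_zero, CV.η_one σ hσ, one_smul] at h

theorem hasDerivAt_W₁ (hσ : σ ∈ CV.I) :
    HasDerivAt (fun s => CV.W₁ s 0)
      ((-(CV.k₁ σ 0)) • CV.T σ 0 + (a * ε₁) • CV.N σ 0) σ := by
  have h := CV.hasDerivAt_fst CV.smooth_W₁ hσ
  rwa [CV.cartan_W₁ σ hσ 0 CV.J_zero, CV.η_one σ hσ, one_smul] at h

theorem hasDerivAt_N (hσ : σ ∈ CV.I) :
    HasDerivAt (fun s => CV.N s 0)
      ((-(ε₁ * CV.k₁ σ 0)) • CV.W₁ σ 0 + (ε₂ * CV.k₂ σ 0) • CV.W₂ σ 0) σ := by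
  have h := CV.hasDerivAt_fst CV.smooth_N hσ
  rwa [CV.cartan_N σ hσ 0 CV.J_zero, CV.η_one σ hσ, one_smul] at h

theorem hasDerivAt_W₂ (hσ : σ ∈ CV.I) :
    HasDerivAt (fun s => CV.W₂ s 0) (CV.k₂ σ 0 • CV.T σ 0) σ := by
  have h := CV.hasDerivAt_fst CV.smooth_W₂ hσ
  rwa [CV.cartan_W₂ σ hσ 0 CV.J_zero, CV.η_one σ hσ, one_smul] at h

theorem hasDerivAt_Vf (hσ : σ ∈ CV.I) :
    HasDerivAt CV.Vf
      (deriv (fun u => CV.T σ u) 0 + deriv (fun u => CV.η σ u) 0 • CV.T σ 0) σ := by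
  refine CV.hasDerivAt_variation CV.smooth_γ hσ (CV.γ_deriv σ hσ) ?_
  have h := (CV.hasDerivAt_snd CV.smooth_η hσ).smul (CV.hasDerivAt_snd CV.smooth_T hσ)
  rwa [CV.η_one σ hσ, one_smul] at h

theorem hasDerivAt_variation_T (hσ : σ ∈ CV.I) :
    HasDerivAt (fun s => deriv (fun u => CV.T s u) 0)
      (a • deriv (fun u => CV.W₁ σ u) 0
        + deriv (fun u => CV.η σ u) 0 • (a • CV.W₁ σ 0)) σ := by
  refine CV.hasDerivAt_variation CV.smooth_T hσ (CV.cartan_T σ hσ) ?_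
  have h := (CV.hasDerivAt_snd CV.smooth_η hσ).smul
    ((CV.hasDerivAt_snd CV.smooth_W₁ hσ).const_smul a)
  rwa [CV.η_one σ hσ, one_smul] at h

theorem hasDerivAt_variation_W₁ (hσ : σ ∈ CV.I) :
    HasDerivAt (fun s => deriv (fun u => CV.W₁ s u) 0)
      ((-(CV.k₁ σ 0)) • deriv (fun u => CV.T σ u) 0
          + (-(deriv (fun u => CV.k₁ σ u) 0)) • CV.T σ 0
          + (a * ε₁) • deriv (fun u => CV.N σ u) 0
        + deriv (fun u => CV.η σ u) 0 •
          ((-(CV.k₁ σ 0)) • CV.T σ 0 + (a * ε₁) • CV.N σ 0)) σ := by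
  refine CV.hasDerivAt_variation CV.smooth_W₁ hσ (CV.cartan_W₁ σ hσ) ?_
  have h := (CV.hasDerivAt_snd CV.smooth_η hσ).smul
    (((CV.hasDerivAt_snd CV.smooth_k₁ hσ).neg.smul (CV.hasDerivAt_snd CV.smooth_T hσ)).add
      ((CV.hasDerivAt_snd CV.smooth_N hσ).const_smul (a * ε₁)))
  rw [CV.η_one σ hσ, one_smul] at h
  exact h

/-- `V″` along `t = 0`. -/
theorem hasDerivAt_deriv_Vf (hσ : σ ∈ CV.I) :
    HasDerivAt (deriv CV.Vf)
      (a • deriv (fun u => CV.W₁ σ u) 0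
        + (2 * a * deriv (fun u => CV.η σ u) 0) • CV.W₁ σ 0
        + deriv (fun s => deriv (fun u => CV.η s u) 0) σ • CV.T σ 0) σ := by
  have e : deriv CV.Vf =ᶠ[nhds σ] fun s =>
      deriv (fun u => CV.T s u) 0 + deriv (fun u => CV.η s u) 0 • CV.T s 0 :=
    Filter.eventually_of_mem (CV.I_open.mem_nhds hσ) fun s hs => (CV.hasDerivAt_Vf hs).deriv
  have hη := CV.hasDerivAt_fst (F := fun s t => deriv (fun u => CV.η s u) t)
    (contDiffOn_deriv_snd CV.domain_open CV.smooth_η) hσ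
  refine (((CV.hasDerivAt_variation_T hσ).add
    (hη.smul (CV.hasDerivAt_T hσ))).congr_deriv ?_).congr_of_eventuallyEq e
  module

theorem phiV_eq (hσ : σ ∈ CV.I) (hTW₁ : B (CV.T σ 0) (CV.W₁ σ 0) = 0) :
    CV.phiV σ = ε₁ * B (deriv (fun u => CV.T σ u) 0) (CV.W₁ σ 0) := by
  simp [phiV, (CV.hasDerivAt_Vf hσ).deriv, hTW₁]

theorem psiV_eq (hσ : σ ∈ CV.I) (hTW₂ : B (CV.T σ 0) (CV.W₂ σ 0) = 0) :
    CV.psiV σ = ε₂ * B (deriv (fun u => CV.T σ u) 0) (CV.W₂ σ 0) := by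
  simp [psiV, (CV.hasDerivAt_Vf hσ).deriv, hTW₂]

theorem bilin_variation_self (hB : ∀ v w, B v w = B w v) {F : ℝ → ℝ → V4} {c : ℝ}
    (hF : ContDiffOn ℝ (⊤ : ℕ∞) (fun p : ℝ × ℝ => F p.1 p.2) (CV.I ×ˢ CV.J))
    (h : ∀ σ ∈ CV.I, ∀ t ∈ CV.J, B (F σ t) (F σ t) = c) (hσ : σ ∈ CV.I) :
    B (deriv (fun u => F σ u) 0) (F σ 0) = 0 := by
  have h' := CV.bilin_variation hF hF h hσ
  rw [hB (F σ 0)] at h'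
  linarith

theorem alphaV_eq (hB : ∀ v w, B v w = B w v) (ha : a ≠ 0) (h₁ : ε₁ * ε₁ = 1)
    (hσ : σ ∈ CV.I) :
    CV.alphaV σ = B (deriv (fun u => CV.T σ u) 0) (CV.N σ 0) := by
  have hTW₁ : ∀ s ∈ CV.I, B (CV.T s 0) (CV.W₁ s 0) = 0 := fun s hs =>
    (hB _ _).trans (CV.B_W₁T s hs 0 CV.J_zero)
  have e : CV.phiV =ᶠ[nhds σ] fun s =>
      ε₁ * B (deriv (fun u => CV.T s u) 0) (CV.W₁ s 0) :=
    Filter.eventually_of_mem (CV.I_open.mem_nhds hσ) fun s hs => CV.phiV_eq hs (hTW₁ s hs)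
  have hφ := ((hasDerivAt_bilin B (CV.hasDerivAt_variation_T hσ)
    (CV.hasDerivAt_W₁ hσ)).const_mul ε₁).deriv
  have hV := CV.hasDerivAt_deriv_Vf hσ
  have hT := CV.bilin_variation_self hB CV.smooth_T CV.B_TT hσ
  have hW₁ := CV.bilin_variation_self hB CV.smooth_W₁ CV.B_W₁W₁ hσ
  rw [alphaV, rhoV, e.deriv_eq, hφ, hV.deriv]
  simp only [map_add, map_smul, LinearMap.add_apply, LinearMap.smul_apply, smul_eq_mul, hT, hW₁,
    hTW₁ σ hσ, CV.B_W₁W₁ σ hσ 0 CV.J_zero]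
  field_simp
  grind

theorem betaV_eq (hB : ∀ v w, B v w = B w v) (ha : a ≠ 0) (h₁ : ε₁ * ε₁ = 1)
    (hσ : σ ∈ CV.I) :
    CV.betaV σ = B (deriv (fun u => CV.W₁ σ u) 0) (CV.N σ 0) := by
  have e : CV.alphaV =ᶠ[nhds σ] fun s => B (deriv (fun u => CV.T s u) 0) (CV.N s 0) :=
    Filter.eventually_of_mem (CV.I_open.mem_nhds hσ) fun s hs => CV.alphaV_eq hB ha h₁ hs
  rw [betaV, e.deriv_eq,
    (hasDerivAt_bilin B (CV.hasDerivAt_variation_T hσ) (CV.hasDerivAt_N hσ)).deriv,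
    CV.phiV_eq hσ ((hB _ _).trans (CV.B_W₁T σ hσ 0 CV.J_zero)),
    CV.psiV_eq hσ ((hB _ _).trans (CV.B_W₂T σ hσ 0 CV.J_zero))]
  simp only [map_add, map_smul, LinearMap.add_apply, LinearMap.smul_apply, smul_eq_mul,
    CV.B_W₁N σ hσ 0 CV.J_zero]
  field_simp
  ring

theorem deriv_psiV (hB : ∀ v w, B v w = B w v) (hσ : σ ∈ CV.I) :
    deriv CV.psiV σ = ε₂ * a * B (deriv (fun u => CV.W₁ σ u) 0) (CV.W₂ σ 0) := by
  have e : CV.psiV =ᶠ[nhds σ] fun s =>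
      ε₂ * B (deriv (fun u => CV.T s u) 0) (CV.W₂ s 0) :=
    Filter.eventually_of_mem (CV.I_open.mem_nhds hσ) fun s hs =>
      CV.psiV_eq hs ((hB _ _).trans (CV.B_W₂T s hs 0 CV.J_zero))
  rw [e.deriv_eq, ((hasDerivAt_bilin B (CV.hasDerivAt_variation_T hσ)
    (CV.hasDerivAt_W₂ hσ)).const_mul ε₂).deriv]
  simp only [map_add, map_smul, LinearMap.add_apply, LinearMap.smul_apply, smul_eq_mul,
    CV.B_W₁W₂ σ hσ 0 CV.J_zero, CV.bilin_variation_self hB CV.smooth_T CV.B_TT hσ]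
  ring

theorem deltaV_eq (hB : ∀ v w, B v w = B w v) (ha : a ≠ 0) (h₁ : ε₁ * ε₁ = 1)
    (hσ : σ ∈ CV.I) :
    CV.deltaV σ = a * ε₁ * ε₂ * B (deriv (fun u => CV.N σ u) 0) (CV.W₂ σ 0) := by
  have hTW₂ : B (CV.T σ 0) (CV.W₂ σ 0) = 0 := (hB _ _).trans (CV.B_W₂T σ hσ 0 CV.J_zero)
  have hNW₂ : B (CV.N σ 0) (CV.W₂ σ 0) = 0 := (hB _ _).trans (CV.B_W₂N σ hσ 0 CV.J_zero)
  have e : deriv CV.psiV =ᶠ[nhds σ] fun s =>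
      ε₂ * a * B (deriv (fun u => CV.W₁ s u) 0) (CV.W₂ s 0) :=
    Filter.eventually_of_mem (CV.I_open.mem_nhds hσ) fun s hs => CV.deriv_psiV hB hs
  have hW₁T := CV.bilin_variation CV.smooth_W₁ CV.smooth_T CV.B_W₁T hσ
  rw [hB (CV.W₁ σ 0), ← eq_neg_iff_add_eq_zero] at hW₁T
  rw [deltaV, e.deriv_eq, ((hasDerivAt_bilin B (CV.hasDerivAt_variation_W₁ hσ)
      (CV.hasDerivAt_W₂ hσ)).const_mul (ε₂ * a)).deriv, CV.psiV_eq hσ hTW₂,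
    CV.phiV_eq hσ ((hB _ _).trans (CV.B_W₁T σ hσ 0 CV.J_zero))]
  simp only [map_add, map_smul, LinearMap.add_apply, LinearMap.smul_apply, smul_eq_mul,
    hTW₂, hNW₂, hW₁T]
  field_simp
  grind

end

end CartanVariation

open CartanVariation in
/-- The variation of the Cartan frame along `t = 0`. -/
theorem stmt3 (B : V4 →ₗ[ℝ] V4 →ₗ[ℝ] ℝ) (hB : ∀ v w, B v w = B w v)
    (a ε₁ ε₂ : ℝ) (ha : 0 < a) (hε₁ : ε₁ = 1 ∨ ε₁ = -1) (hε₂ : ε₂ = 1 ∨ ε₂ = -1)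
    (CV : CartanVariation B a ε₁ ε₂) :
    ∀ σ ∈ CV.I,
      deriv (fun u => CV.T σ u) 0 =
          (-(CV.alphaV σ)) • CV.T σ 0 + CV.phiV σ • CV.W₁ σ 0 + CV.psiV σ • CV.W₂ σ 0 ∧
      deriv (fun u => CV.W₁ σ u) 0 =
          (-(CV.betaV σ)) • CV.T σ 0 + (ε₁ * CV.phiV σ) • CV.N σ 0
            + ((1 / a) * deriv CV.psiV σ) • CV.W₂ σ 0 ∧
      deriv (fun u => CV.N σ u) 0 =
          (-(ε₁ * CV.betaV σ)) • CV.W₁ σ 0 + CV.alphaV σ • CV.N σ 0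
            + ((ε₁ / a) * CV.deltaV σ) • CV.W₂ σ 0 ∧
      deriv (fun u => CV.W₂ σ u) 0 =
          ((ε₁ * ε₂ / a) * CV.deltaV σ) • CV.T σ 0
            + (-(ε₁ * ε₂ / a) * deriv CV.psiV σ) • CV.W₁ σ 0
            + (ε₂ * CV.psiV σ) • CV.N σ 0 := by
  intro σ hσ
  have h₁ : ε₁ * ε₁ = 1 := by rcases hε₁ with rfl | rfl <;> norm_num
  have h₂ : ε₂ * ε₂ = 1 := by rcases hε₂ with rfl | rfl <;> norm_num
  have ha' : a ≠ 0 := ha.ne'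
  have hTW₁ : B (CV.T σ 0) (CV.W₁ σ 0) = 0 := (hB _ _).trans (CV.B_W₁T σ hσ 0 CV.J_zero)
  have hTW₂ : B (CV.T σ 0) (CV.W₂ σ 0) = 0 := (hB _ _).trans (CV.B_W₂T σ hσ 0 CV.J_zero)
  have expand := cartan_frame_expansion hB h₁ h₂
    (CV.B_TT σ hσ 0 CV.J_zero) (CV.B_NN σ hσ 0 CV.J_zero) (CV.B_TN σ hσ 0 CV.J_zero)
    (CV.B_W₁T σ hσ 0 CV.J_zero) (CV.B_W₁N σ hσ 0 CV.J_zero) (CV.B_W₂T σ hσ 0 CV.J_zero)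
    (CV.B_W₂N σ hσ 0 CV.J_zero) (CV.B_W₁W₂ σ hσ 0 CV.J_zero) (CV.B_W₁W₁ σ hσ 0 CV.J_zero)
    (CV.B_W₂W₂ σ hσ 0 CV.J_zero)
  have dTT := CV.bilin_variation_self hB CV.smooth_T CV.B_TT hσ
  have dNN := CV.bilin_variation_self hB CV.smooth_N CV.B_NN hσ
  have dW₁W₁ := CV.bilin_variation_self hB CV.smooth_W₁ CV.B_W₁W₁ hσ
  have dW₂W₂ := CV.bilin_variation_self hB CV.smooth_W₂ CV.B_W₂W₂ hσ
  have dTN := CV.bilin_variation CV.smooth_T CV.smooth_N CV.B_TN hσ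
  have dW₁T := CV.bilin_variation CV.smooth_W₁ CV.smooth_T CV.B_W₁T hσ
  have dW₁N := CV.bilin_variation CV.smooth_W₁ CV.smooth_N CV.B_W₁N hσ
  have dW₂T := CV.bilin_variation CV.smooth_W₂ CV.smooth_T CV.B_W₂T hσ
  have dW₂N := CV.bilin_variation CV.smooth_W₂ CV.smooth_N CV.B_W₂N hσ
  have dW₁W₂ := CV.bilin_variation CV.smooth_W₁ CV.smooth_W₂ CV.B_W₁W₂ hσ
  rw [hB (CV.T σ 0)] at dTN
  rw [hB (CV.W₁ σ 0)] at dW₁T dW₁N dW₁W₂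
  rw [hB (CV.W₂ σ 0)] at dW₂T dW₂N
  rw [CV.deriv_psiV hB hσ, CV.alphaV_eq hB ha' h₁ hσ, CV.betaV_eq hB ha' h₁ hσ,
    CV.deltaV_eq hB ha' h₁ hσ, CV.phiV_eq hσ hTW₁, CV.psiV_eq hσ hTW₂]
  refine ⟨(expand _).trans ?_, (expand _).trans ?_, (expand _).trans ?_, (expand _).trans ?_⟩
  · rw [dTT]
    module
  · rw [dW₁W₁, eq_neg_of_add_eq_zero_left dW₁T]
    match_scalars <;> field_simp <;> grind
  · rw [dNN, eq_neg_of_add_eq_zero_right dTN, eq_neg_of_add_eq_zero_right dW₁N]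
    match_scalars <;> field_simp <;> grind
  · rw [dW₂W₂, eq_neg_of_add_eq_zero_left dW₂T, eq_neg_of_add_eq_zero_left dW₂N,
      eq_neg_of_add_eq_zero_right dW₁W₂]
    match_scalars <;> field_simp <;> grind
end
end

section
/- Let V₁, V₂ ∈ 𝔛* and write V₁₂ = [V₁, V₂], with φᵢ = φ_{Vᵢ}, ψᵢ = ψ_{Vᵢ}, ρᵢ = ρ_{Vᵢ}, gᵢ = g_{Vᵢ}, lᵢ = l_{Vᵢ}. Then: φ_{V₁₂} = V̂₁(φ₂) − V̂₂(φ₁) + (1/(2a))(ρ₁φ₂ − ρ₂φ₁) + (1/a)(φ₁′φ₂ − φ₁φ₂′) + (ε₁ε₂/a)(ψ₁ψ₂′ − ψ₁′ψ₂) + (ε₁/a)·G·(g₂′g₁ − g₂g₁′); ψ_{V₁₂} = V̂₁(ψ₂) − V̂₂(ψ₁) + (1/(2a))(ρ₁ψ₂ − ρ₂ψ₁) + (1/a)(ψ₁′φ₂ − ψ₁φ₂′ + ψ₂φ₁′ − ψ₂′φ₁) + G·(l₁g₂ − l₂g₁); and ρ_{V₁₂} = V̂₁(ρ₂) − V̂₂(ρ₁).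 -/
noncomputable section
open MvPolynomial

/-- The differential algebra `𝒫`: polynomials in `k₁⁽ᵐ⁾ = X (0, m)` and `k₂⁽ᵐ⁾ = X (1, m)`. -/
abbrev PP : Type := MvPolynomial (Fin 2 × ℕ) ℝ

/-- The derivation `f ↦ f′` with `D (kᵢ⁽ᵐ⁾) = kᵢ⁽ᵐ⁺¹⁾`. -/
def Dx : Derivation ℝ PP PP :=
  MvPolynomial.mkDerivation ℝ (fun im : Fin 2 × ℕ => MvPolynomial.X (im.1, im.2 + 1))

def k1 : PP := MvPolynomial.X (0, 0)
def k2 : PP := MvPolynomial.X (1, 0)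

/-- A `𝒫`-local vector field: a quadruple `(f, h, g, l) ∈ 𝒫⁴`. -/
structure LVF where
  f : PP
  h : PP
  g : PP
  l : PP

namespace LVF

instance : Zero LVF := ⟨⟨0, 0, 0, 0⟩⟩
instance : Neg LVF := ⟨fun U => ⟨-U.f, -U.h, -U.g, -U.l⟩⟩
instance : Add LVF := ⟨fun U W => ⟨U.f + W.f, U.h + W.h, U.g + W.g, U.l + W.l⟩⟩
instance : Sub LVF := ⟨fun U W => ⟨U.f - W.f, U.h - W.h, U.g - W.g, U.l - W.l⟩⟩

def phi (a ε₁ : ℝ) (V : LVF) : PP := C a * V.f + Dx V.h - C ε₁ * k1 * V.g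

def psi (ε₂ : ℝ) (V : LVF) : PP := Dx V.l + C ε₂ * k2 * V.g

def rho (a ε₁ : ℝ) (V : LVF) : PP :=
  - C a * Dx V.f + C (2 * a) * k1 * V.h - C a * k2 * V.l
    - Dx (phi a ε₁ V) + C ε₁ * k1 * Dx V.g

/-- Membership in `𝔛*`: `g_V′ = −ε₁·a·h_V`. -/
def isStar (a ε₁ : ℝ) (V : LVF) : Prop := Dx V.g = - C (ε₁ * a) * V.h

def alpha (a ε₁ : ℝ) (V : LVF) : PP :=
  C (1 / a) * (Dx (phi a ε₁ V) + C (1 / 2) * rho a ε₁ V)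

def beta (a ε₁ ε₂ G : ℝ) (V : LVF) : PP :=
  C (1 / a) * (Dx (alpha a ε₁ V) + k1 * phi a ε₁ V - k2 * psi ε₂ V - C G * V.g)

def delta (a ε₁ ε₂ : ℝ) (V : LVF) : PP :=
  C (1 / a) * Dx (Dx (psi ε₂ V)) + k1 * psi ε₂ V + C (ε₁ * ε₂) * k2 * phi a ε₁ V

/-- The value `V̂(k₁)`. -/
def vk1 (a ε₁ ε₂ G : ℝ) (V : LVF) : PP :=
  C (1 / a ^ 2) * Dx (Dx (Dx (phi a ε₁ V)))
    + C (1 / a) * (Dx (k1 * phi a ε₁ V) + k1 * Dx (phi a ε₁ V))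
    - C (1 / a) * (Dx (k2 * psi ε₂ V) + k2 * Dx (psi ε₂ V))
    + C (1 / a) * (C (1 / (2 * a)) * Dx (Dx (rho a ε₁ V)) + k1 * rho a ε₁ V
        - C (2 * G) * Dx V.g)

/-- The value `V̂(k₂)`. -/
def vk2 (a ε₁ ε₂ G : ℝ) (V : LVF) : PP :=
  C (ε₁ * ε₂ / a ^ 2) * Dx (Dx (Dx (psi ε₂ V)))
    + C (ε₁ * ε₂ / a) * (Dx (k1 * psi ε₂ V) + k1 * Dx (psi ε₂ V))
    + C (1 / a) * (Dx (k2 * phi a ε₁ V) + k2 * Dx (phi a ε₁ V))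
    + C (1 / a) * (k2 * rho a ε₁ V) - C (ε₂ * G) * V.l

/-- Values of `V̂` on the generators, defined by the recursion
`V̂(kᵢ⁽ᵐ⁺¹⁾) = (V̂(kᵢ⁽ᵐ⁾))′ + (1/(2a))·ρ_V·kᵢ⁽ᵐ⁺¹⁾`. -/
def vhatFun (a ε₁ ε₂ G : ℝ) (V : LVF) : Fin 2 × ℕ → PP := fun im =>
  Nat.rec (motive := fun _ => PP)
    (if im.1 = 0 then vk1 a ε₁ ε₂ G V else vk2 a ε₁ ε₂ G V)
    (fun m prev => Dx prev + C (1 / (2 * a)) * rho a ε₁ V * MvPolynomial.X (im.1, m + 1))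
    im.2

/-- The derivation `V̂` attached to `V ∈ 𝔛*`. -/
def vhat (a ε₁ ε₂ G : ℝ) (V : LVF) : Derivation ℝ PP PP :=
  MvPolynomial.mkDerivation ℝ (vhatFun a ε₁ ε₂ G V)

/-- The operator `D_V U`. -/
def DV (a ε₁ ε₂ G : ℝ) (V U : LVF) : LVF where
  f := vhat a ε₁ ε₂ G V U.f - alpha a ε₁ V * U.f - beta a ε₁ ε₂ G V * U.h
        + C (ε₁ * ε₂ / a) * delta a ε₁ ε₂ V * U.l
  h := vhat a ε₁ ε₂ G V U.h + phi a ε₁ V * U.f - C ε₁ * beta a ε₁ ε₂ G V * U.g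
        - C (ε₁ * ε₂ / a) * Dx (psi ε₂ V) * U.l
  g := vhat a ε₁ ε₂ G V U.g + C ε₁ * phi a ε₁ V * U.h + alpha a ε₁ V * U.g
        + C ε₂ * psi ε₂ V * U.l
  l := vhat a ε₁ ε₂ G V U.l + psi ε₂ V * U.f + C (1 / a) * Dx (psi ε₂ V) * U.h
        + C (ε₁ / a) * delta a ε₁ ε₂ V * U.g

/-- The bracket `[V₁, V₂] = D_{V₁}V₂ − D_{V₂}V₁`. -/
def bracket (a ε₁ ε₂ G : ℝ) (V₁ V₂ : LVF) : LVF :=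
  DV a ε₁ ε₂ G V₁ V₂ - DV a ε₁ ε₂ G V₂ V₁

end LVF

namespace LVF

lemma Dx_C (x : ℝ) : Dx (C x) = 0 := Dx.map_algebraMap x

lemma vhat_C (a ε₁ ε₂ G : ℝ) (V : LVF) (x : ℝ) : vhat a ε₁ ε₂ G V (C x) = 0 :=
  (vhat a ε₁ ε₂ G V).map_algebraMap x

lemma vhat_k1 (a ε₁ ε₂ G : ℝ) (V : LVF) : vhat a ε₁ ε₂ G V k1 = vk1 a ε₁ ε₂ G V := by
  simp [vhat, k1, mkDerivation_X, vhatFun]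

lemma vhat_k2 (a ε₁ ε₂ G : ℝ) (V : LVF) : vhat a ε₁ ε₂ G V k2 = vk2 a ε₁ ε₂ G V := by
  simp [vhat, k2, mkDerivation_X, vhatFun]

/-- The derivation `V̂` commutes with `D` up to the multiple `ρ_V / (2a)` of `D`. -/
lemma vhat_Dx (a ε₁ ε₂ G : ℝ) (V : LVF) (p : PP) :
    vhat a ε₁ ε₂ G V (Dx p) =
      Dx (vhat a ε₁ ε₂ G V p) + C (1 / (2 * a)) * rho a ε₁ V * Dx p := by
  have h : ⁅vhat a ε₁ ε₂ G V, Dx⁆ = (C (1 / (2 * a)) * rho a ε₁ V) • Dx := by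
    refine MvPolynomial.derivation_ext fun i => ?_
    simp only [Derivation.commutator_apply, Derivation.smul_apply, smul_eq_mul]
    simp only [Dx, vhat, mkDerivation_X]
    simp only [vhatFun, Dx]
    ring
  have hp := DFunLike.congr_fun h p
  simp only [Derivation.commutator_apply, Derivation.smul_apply, smul_eq_mul] at hp
  linear_combination hp

lemma Dx_h (a ε₁ : ℝ) (V : LVF) :
    Dx V.h = phi a ε₁ V - C a * V.f + C ε₁ * k1 * V.g := by
  unfold phi; ring

lemma Dx_l (ε₂ : ℝ) (V : LVF) : Dx V.l = psi ε₂ V - C ε₂ * k2 * V.g := by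
  unfold psi; ring

lemma Dx_f (a ε₁ : ℝ) (ha : a ≠ 0) (V : LVF) :
    Dx V.f = C (1 / a) * (C (2 * a) * k1 * V.h - C a * k2 * V.l - Dx (phi a ε₁ V)
      + C ε₁ * k1 * Dx V.g - rho a ε₁ V) := by
  have h : (C (1 / a) : PP) * C a = 1 := by rw [← C_mul, one_div_mul_cancel ha, C_1]
  unfold rho
  linear_combination (-Dx V.f) * h

lemma bracket_f (a ε₁ ε₂ G : ℝ) (V₁ V₂ : LVF) :
    (bracket a ε₁ ε₂ G V₁ V₂).f = (DV a ε₁ ε₂ G V₁ V₂).f - (DV a ε₁ ε₂ G V₂ V₁).f := rfl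

lemma bracket_h (a ε₁ ε₂ G : ℝ) (V₁ V₂ : LVF) :
    (bracket a ε₁ ε₂ G V₁ V₂).h = (DV a ε₁ ε₂ G V₁ V₂).h - (DV a ε₁ ε₂ G V₂ V₁).h := rfl

lemma bracket_g (a ε₁ ε₂ G : ℝ) (V₁ V₂ : LVF) :
    (bracket a ε₁ ε₂ G V₁ V₂).g = (DV a ε₁ ε₂ G V₁ V₂).g - (DV a ε₁ ε₂ G V₂ V₁).g := rfl

lemma bracket_l (a ε₁ ε₂ G : ℝ) (V₁ V₂ : LVF) :
    (bracket a ε₁ ε₂ G V₁ V₂).l = (DV a ε₁ ε₂ G V₁ V₂).l - (DV a ε₁ ε₂ G V₂ V₁).l := rfl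

lemma vhat_phi (a ε₁ ε₂ G : ℝ) (V U : LVF) :
    vhat a ε₁ ε₂ G V (phi a ε₁ U) = C a * vhat a ε₁ ε₂ G V U.f + Dx (vhat a ε₁ ε₂ G V U.h)
      + C (1 / (2 * a)) * rho a ε₁ V * Dx U.h
      - C ε₁ * (vk1 a ε₁ ε₂ G V * U.g + k1 * vhat a ε₁ ε₂ G V U.g) := by
  rw [phi]
  simp only [map_add, map_sub, Derivation.leibniz, smul_eq_mul, vhat_C, vhat_k1, vhat_Dx]
  ring

lemma vhat_psi (a ε₁ ε₂ G : ℝ) (V U : LVF) :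
    vhat a ε₁ ε₂ G V (psi ε₂ U) = Dx (vhat a ε₁ ε₂ G V U.l)
      + C (1 / (2 * a)) * rho a ε₁ V * Dx U.l
      + C ε₂ * (vk2 a ε₁ ε₂ G V * U.g + k2 * vhat a ε₁ ε₂ G V U.g) := by
  rw [psi]
  simp only [map_add, Derivation.leibniz, smul_eq_mul, vhat_C, vhat_k2, vhat_Dx]
  ring

lemma vhat_rho (a ε₁ ε₂ G : ℝ) (V U : LVF) :
    vhat a ε₁ ε₂ G V (rho a ε₁ U) =
      - C a * (Dx (vhat a ε₁ ε₂ G V U.f) + C (1 / (2 * a)) * rho a ε₁ V * Dx U.f)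
      + C (2 * a) * (vk1 a ε₁ ε₂ G V * U.h + k1 * vhat a ε₁ ε₂ G V U.h)
      - C a * (vk2 a ε₁ ε₂ G V * U.l + k2 * vhat a ε₁ ε₂ G V U.l)
      - (Dx (vhat a ε₁ ε₂ G V (phi a ε₁ U)) + C (1 / (2 * a)) * rho a ε₁ V * Dx (phi a ε₁ U))
      + C ε₁ * (vk1 a ε₁ ε₂ G V * Dx U.g
        + k1 * (Dx (vhat a ε₁ ε₂ G V U.g) + C (1 / (2 * a)) * rho a ε₁ V * Dx U.g)) := by
  rw [rho]
  simp only [map_add, map_sub, map_neg, Derivation.leibniz, smul_eq_mul, vhat_C, vhat_k1,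
    vhat_k2, vhat_Dx]
  ring

/-- `𝒫` embeds into a field of characteristic zero, compatibly with its scalars. -/
lemma exists_field_embedding : ∃ (K : Type) (_ : Field K) (_ : CharZero K) (e : PP →+* K)
    (c : ℝ →+* K), Function.Injective e ∧ ∀ x, e (C x) = c x :=
  ⟨FractionRing PP, inferInstance, inferInstance, algebraMap PP (FractionRing PP),
    (algebraMap PP (FractionRing PP)).comp C, FaithfulSMul.algebraMap_injective _ _, fun _ => rfl⟩

set_option maxHeartbeats 1000000 in
lemma phi_bracket (a ε₁ ε₂ G : ℝ) (ha : a ≠ 0) (hε₁ : ε₁ = 1 ∨ ε₁ = -1)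
    (hε₂ : ε₂ = 1 ∨ ε₂ = -1) (V₁ V₂ : LVF)
    (h₁ : LVF.isStar a ε₁ V₁) (h₂ : LVF.isStar a ε₁ V₂) :
    phi a ε₁ (bracket a ε₁ ε₂ G V₁ V₂) =
        vhat a ε₁ ε₂ G V₁ (phi a ε₁ V₂) - vhat a ε₁ ε₂ G V₂ (phi a ε₁ V₁)
          + C (1 / (2 * a)) * (rho a ε₁ V₁ * phi a ε₁ V₂ - rho a ε₁ V₂ * phi a ε₁ V₁)
          + C (1 / a) * (Dx (phi a ε₁ V₁) * phi a ε₁ V₂ - phi a ε₁ V₁ * Dx (phi a ε₁ V₂))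
          + C (ε₁ * ε₂ / a) * (psi ε₂ V₁ * Dx (psi ε₂ V₂) - Dx (psi ε₂ V₁) * psi ε₂ V₂)
          + C (ε₁ / a) * C G * (Dx V₂.g * V₁.g - V₂.g * Dx V₁.g) := by
  unfold isStar at h₁ h₂
  rw [phi, vhat_phi, vhat_phi]
  simp only [bracket_f, bracket_h, bracket_g, DV, vk1, beta, alpha, delta]
  simp only [map_add, map_sub, Derivation.leibniz, smul_eq_mul, Dx_C,
    Dx_h a ε₁, Dx_l ε₂, Dx_f a ε₁ ha, h₁, h₂]
  obtain ⟨K, _, _, e, c, he, hc⟩ := exists_field_embedding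
  apply he
  have hA : c a ≠ 0 := (map_ne_zero c).2 ha
  simp only [map_add, map_sub, map_mul, map_neg, map_zero, hc, map_div₀, map_one, map_ofNat,
    map_pow]
  have hE₁ : c ε₁ = 1 ∨ c ε₁ = -1 := by rcases hε₁ with rfl | rfl <;> simp
  have hE₂ : c ε₂ = 1 ∨ c ε₂ = -1 := by rcases hε₂ with rfl | rfl <;> simp
  rcases hE₁ with h | h <;> rcases hE₂ with h' | h' <;>
  · rw [h, h']
    field_simp
    ring

set_option maxHeartbeats 1000000 in
lemma psi_bracket (a ε₁ ε₂ G : ℝ) (ha : a ≠ 0) (hε₁ : ε₁ = 1 ∨ ε₁ = -1)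
    (hε₂ : ε₂ = 1 ∨ ε₂ = -1) (V₁ V₂ : LVF)
    (h₁ : LVF.isStar a ε₁ V₁) (h₂ : LVF.isStar a ε₁ V₂) :
    psi ε₂ (bracket a ε₁ ε₂ G V₁ V₂) =
        vhat a ε₁ ε₂ G V₁ (psi ε₂ V₂) - vhat a ε₁ ε₂ G V₂ (psi ε₂ V₁)
          + C (1 / (2 * a)) * (rho a ε₁ V₁ * psi ε₂ V₂ - rho a ε₁ V₂ * psi ε₂ V₁)
          + C (1 / a) * (Dx (psi ε₂ V₁) * phi a ε₁ V₂ - psi ε₂ V₁ * Dx (phi a ε₁ V₂)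
              + psi ε₂ V₂ * Dx (phi a ε₁ V₁) - Dx (psi ε₂ V₂) * phi a ε₁ V₁)
          + C G * (V₁.l * V₂.g - V₂.l * V₁.g) := by
  unfold isStar at h₁ h₂
  rw [psi, vhat_psi, vhat_psi]
  simp only [bracket_l, bracket_g, DV, vk2, alpha, delta]
  simp only [map_add, map_sub, Derivation.leibniz, smul_eq_mul, Dx_C,
    Dx_h a ε₁, Dx_l ε₂, Dx_f a ε₁ ha, h₁, h₂]
  obtain ⟨K, _, _, e, c, he, hc⟩ := exists_field_embedding
  apply he
  have hA : c a ≠ 0 := (map_ne_zero c).2 ha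
  simp only [map_add, map_sub, map_mul, map_neg, map_zero, hc, map_div₀, map_one, map_ofNat,
    map_pow]
  have hE₁ : c ε₁ = 1 ∨ c ε₁ = -1 := by rcases hε₁ with rfl | rfl <;> simp
  have hE₂ : c ε₂ = 1 ∨ c ε₂ = -1 := by rcases hε₂ with rfl | rfl <;> simp
  rcases hE₁ with h | h <;> rcases hE₂ with h' | h' <;>
  · rw [h, h']
    field_simp
    ring

set_option maxHeartbeats 4000000 in
lemma rho_bracket (a ε₁ ε₂ G : ℝ) (ha : a ≠ 0) (hε₁ : ε₁ = 1 ∨ ε₁ = -1)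
    (hε₂ : ε₂ = 1 ∨ ε₂ = -1) (V₁ V₂ : LVF)
    (h₁ : LVF.isStar a ε₁ V₁) (h₂ : LVF.isStar a ε₁ V₂) :
    rho a ε₁ (bracket a ε₁ ε₂ G V₁ V₂) =
      vhat a ε₁ ε₂ G V₁ (rho a ε₁ V₂) - vhat a ε₁ ε₂ G V₂ (rho a ε₁ V₁) := by
  rw [rho, phi_bracket a ε₁ ε₂ G ha hε₁ hε₂ V₁ V₂ h₁ h₂, vhat_rho, vhat_rho]
  unfold isStar at h₁ h₂
  simp only [bracket_f, bracket_h, bracket_g, bracket_l, DV, vk1, vk2, beta, alpha, delta]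
  simp only [map_add, map_sub, map_neg, map_zero, Derivation.leibniz, smul_eq_mul, Dx_C,
    Dx_h a ε₁, Dx_l ε₂, Dx_f a ε₁ ha, h₁, h₂]
  obtain ⟨K, _, _, e, c, he, hc⟩ := exists_field_embedding
  apply he
  have hA : c a ≠ 0 := (map_ne_zero c).2 ha
  simp only [map_add, map_sub, map_mul, map_neg, map_zero, hc, map_div₀, map_one, map_ofNat,
    map_pow]
  have hE₁ : c ε₁ = 1 ∨ c ε₁ = -1 := by rcases hε₁ with rfl | rfl <;> simp
  have hE₂ : c ε₂ = 1 ∨ c ε₂ = -1 := by rcases hε₂ with rfl | rfl <;> simp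
  rcases hE₁ with h | h <;> rcases hE₂ with h' | h' <;>
  · rw [h, h']
    field_simp
    ring

end LVF

open LVF in
/-- Formulas for `φ`, `ψ` and `ρ` of the bracket `[V₁, V₂]`. -/
theorem stmt10 (a ε₁ ε₂ G : ℝ) (ha : a ≠ 0) (hε₁ : ε₁ = 1 ∨ ε₁ = -1)
    (hε₂ : ε₂ = 1 ∨ ε₂ = -1) (V₁ V₂ : LVF)
    (h₁ : LVF.isStar a ε₁ V₁) (h₂ : LVF.isStar a ε₁ V₂) :
    phi a ε₁ (bracket a ε₁ ε₂ G V₁ V₂) =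
        vhat a ε₁ ε₂ G V₁ (phi a ε₁ V₂) - vhat a ε₁ ε₂ G V₂ (phi a ε₁ V₁)
          + MvPolynomial.C (1 / (2 * a)) * (rho a ε₁ V₁ * phi a ε₁ V₂ - rho a ε₁ V₂ * phi a ε₁ V₁)
          + MvPolynomial.C (1 / a) * (Dx (phi a ε₁ V₁) * phi a ε₁ V₂ - phi a ε₁ V₁ * Dx (phi a ε₁ V₂))
          + MvPolynomial.C (ε₁ * ε₂ / a) * (psi ε₂ V₁ * Dx (psi ε₂ V₂) - Dx (psi ε₂ V₁) * psi ε₂ V₂)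
          + MvPolynomial.C (ε₁ / a) * MvPolynomial.C G * (Dx V₂.g * V₁.g - V₂.g * Dx V₁.g) ∧
      psi ε₂ (bracket a ε₁ ε₂ G V₁ V₂) =
        vhat a ε₁ ε₂ G V₁ (psi ε₂ V₂) - vhat a ε₁ ε₂ G V₂ (psi ε₂ V₁)
          + MvPolynomial.C (1 / (2 * a)) * (rho a ε₁ V₁ * psi ε₂ V₂ - rho a ε₁ V₂ * psi ε₂ V₁)
          + MvPolynomial.C (1 / a) * (Dx (psi ε₂ V₁) * phi a ε₁ V₂ - psi ε₂ V₁ * Dx (phi a ε₁ V₂)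
              + psi ε₂ V₂ * Dx (phi a ε₁ V₁) - Dx (psi ε₂ V₂) * phi a ε₁ V₁)
          + MvPolynomial.C G * (V₁.l * V₂.g - V₂.l * V₁.g) ∧
      rho a ε₁ (bracket a ε₁ ε₂ G V₁ V₂) =
        vhat a ε₁ ε₂ G V₁ (rho a ε₁ V₂) - vhat a ε₁ ε₂ G V₂ (rho a ε₁ V₁) := by
  exact ⟨phi_bracket a ε₁ ε₂ G ha hε₁ hε₂ V₁ V₂ h₁ h₂, psi_bracket a ε₁ ε₂ G ha hε₁ hε₂ V₁ V₂ h₁ h₂,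
    rho_bracket a ε₁ ε₂ G ha hε₁ hε₂ V₁ V₂ h₁ h₂⟩
end
end
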